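/- Let f: ℝ^d → ℝ^d be C², globally Lipschitz with constant L such that for each component i, ‖∇²f_i(θ)‖·‖θ−θ*‖ ≤ K for all θ, where f(θ*) = 0. Let s(t,θ) be the flow of θ' = f(θ). Then there is a finite constant C₃ (depending on d, K, L, T) such that for all t ∈ [0,T], all θ ≠ θ*, and all indices i, j, k, |∂²s_i(t,θ)/∂θ_j∂θ_k| ≤ C₃/‖θ − θ*‖. -/

import Mathlib

open Filter Topology Metric

/-- A Lipschitz function whose second differences based at `x` are `O(‖u‖ ‖v‖)` is differentiable
at `x`. -/
lemma LipschitzWith.differentiableAt_of_norm_second_difference_le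
    {E F : Type*} [NormedAddCommGroup E] [NormedSpace ℝ E] [NormedAddCommGroup F]
    [NormedSpace ℝ F] [ProperSpace F] {g : E → F} {M : NNReal} (hg : LipschitzWith M g)
    {x : E} {C r : ℝ} (hC : 0 ≤ C) (hr : 0 < r)
    (h : ∀ u v : E, ‖u‖ ≤ r → ‖v‖ ≤ r →
      ‖g (x + u + v) - g (x + u) - g (x + v) + g x‖ ≤ C * ‖u‖ * ‖v‖) :
    DifferentiableAt ℝ g x := by
  set q : ℕ → E → F := fun n u => (2 : ℝ) ^ n • (g (x + (2⁻¹ : ℝ) ^ n • u) - g x) with hq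
  have hpow (n : ℕ) : (2 : ℝ) ^ n * (2⁻¹ : ℝ) ^ n = 1 := by rw [← mul_pow]; norm_num
  have hnorm (n : ℕ) (u : E) : ‖(2⁻¹ : ℝ) ^ n • u‖ = (2⁻¹ : ℝ) ^ n * ‖u‖ := by
    rw [norm_smul, Real.norm_of_nonneg (by positivity)]
  have hq_le (n : ℕ) (u : E) : ‖q n u‖ ≤ M * ‖u‖ := by
    have h1 := hg.norm_sub_le (x + (2⁻¹ : ℝ) ^ n • u) x
    rw [add_sub_cancel_left, hnorm] at h1
    rw [hq, norm_smul, Real.norm_of_nonneg (by positivity)]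
    calc (2 : ℝ) ^ n * ‖g (x + (2⁻¹ : ℝ) ^ n • u) - g x‖
        ≤ 2 ^ n * (M * ((2⁻¹ : ℝ) ^ n * ‖u‖)) := by gcongr
      _ = (2 ^ n * (2⁻¹ : ℝ) ^ n) * (M * ‖u‖) := by ring
      _ = M * ‖u‖ := by rw [hpow, one_mul]
  set U : Ultrafilter ℕ := hyperfilter ℕ
  have hU : (U : Filter ℕ) ≤ atTop := Nat.hyperfilter_le_atTop
  have hlim (u : E) : ∃ a, Tendsto (fun n => q n u) U (𝓝 a) := by
    obtain ⟨a, -, ha⟩ := (isCompact_closedBall (0 : F) (M * ‖u‖)).ultrafilter_le_nhds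
      (U.map fun n => q n u)
      (tendsto_principal.mpr (Eventually.of_forall fun n =>
        mem_closedBall_zero_iff.mpr (hq_le n u)))
    exact ⟨a, ha⟩
  choose A hA using hlim
  have hsmall (u : E) : ∀ᶠ n in atTop, ‖(2⁻¹ : ℝ) ^ n • u‖ ≤ r := by
    have : Tendsto (fun n : ℕ => (2⁻¹ : ℝ) ^ n * ‖u‖) atTop (𝓝 (0 * ‖u‖)) :=
      (tendsto_pow_atTop_nhds_zero_of_lt_one (by norm_num) (by norm_num)).mul_const _
    rw [zero_mul] at this
    filter_upwards [this.eventually (ge_mem_nhds hr)] with n hn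
    rwa [hnorm]
  have hA_add (u v : E) : A (u + v) = A u + A v := by
    have h1 : Tendsto (fun n => q n (u + v) - q n u - q n v) atTop (𝓝 0) := by
      have h0 : Tendsto (fun n : ℕ => (2⁻¹ : ℝ) ^ n * (C * ‖u‖ * ‖v‖)) atTop
          (𝓝 (0 * (C * ‖u‖ * ‖v‖))) :=
        (tendsto_pow_atTop_nhds_zero_of_lt_one (by norm_num) (by norm_num)).mul_const _
      rw [zero_mul] at h0
      refine squeeze_zero_norm' ?_ h0
      filter_upwards [hsmall u, hsmall v] with n hu hv
      have h2 := h _ _ hu hv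
      rw [hnorm, hnorm] at h2
      have h3 : q n (u + v) - q n u - q n v = (2 : ℝ) ^ n •
          (g (x + (2⁻¹ : ℝ) ^ n • u + (2⁻¹ : ℝ) ^ n • v) - g (x + (2⁻¹ : ℝ) ^ n • u)
            - g (x + (2⁻¹ : ℝ) ^ n • v) + g x) := by
        simp only [hq, smul_add, ← add_assoc]
        rw [← smul_sub, ← smul_sub, ← smul_add]
        simp only [smul_sub, smul_add]
        abel
      rw [h3, norm_smul, Real.norm_of_nonneg (by positivity)]
      calc _ ≤ (2 : ℝ) ^ n * (C * ((2⁻¹ : ℝ) ^ n * ‖u‖) * ((2⁻¹ : ℝ) ^ n * ‖v‖)) := by gcongr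
        _ = (2 ^ n * (2⁻¹ : ℝ) ^ n) * ((2⁻¹ : ℝ) ^ n * (C * ‖u‖ * ‖v‖)) := by ring
        _ = _ := by rw [hpow, one_mul]
    have h2 := tendsto_nhds_unique (h1.mono_left hU) (((hA (u + v)).sub (hA u)).sub (hA v))
    rw [sub_sub] at h2
    exact sub_eq_zero.mp h2.symm
  have hA_le (u : E) : ‖A u‖ ≤ M * ‖u‖ :=
    le_of_tendsto (hA u).norm (Eventually.of_forall fun n => hq_le n u)
  let A₀ : E →+ F := AddMonoidHom.mk' A hA_add
  let A' : E →L[ℝ] F := A₀.toRealLinearMap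
    (AddMonoidHomClass.continuous_of_bound A₀ M hA_le)
  have hq_sub (u : E) (hu : ‖u‖ ≤ r) (n : ℕ) :
      ‖q n u - q 0 u‖ ≤ C * ‖u‖ ^ 2 * (1 - (2⁻¹ : ℝ) ^ n) := by
    induction n with
    | zero => simp
    | succ n ih =>
      set w := (2⁻¹ : ℝ) ^ (n + 1) • u with hw
      have hw_norm : ‖w‖ = (2⁻¹ : ℝ) ^ (n + 1) * ‖u‖ := hnorm _ _
      have hwr : ‖w‖ ≤ r := by
        rw [hw_norm]
        exact (mul_le_of_le_one_left (norm_nonneg _)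
          (pow_le_one₀ (by norm_num) (by norm_num))).trans hu
      have hww : (2⁻¹ : ℝ) ^ n • u = w + w := by
        rw [hw, ← add_smul, pow_succ]; congr 1; ring
      have h3 : q (n + 1) u - q n u =
          -((2 : ℝ) ^ n • (g (x + w + w) - g (x + w) - g (x + w) + g x)) := by
        simp only [hq]
        rw [← hw, hww, pow_succ, ← add_assoc]
        module
      have h4 : ‖q (n + 1) u - q n u‖ ≤ C * ‖u‖ ^ 2 * (2⁻¹ : ℝ) ^ (n + 1) := by
        have h5 := h w w hwr hwr
        rw [h3, norm_neg, norm_smul, Real.norm_of_nonneg (by positivity)]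
        calc _ ≤ (2 : ℝ) ^ n * (C * ‖w‖ * ‖w‖) := by gcongr
          _ = (2 ^ n * (2⁻¹ : ℝ) ^ n) * (2⁻¹ * (C * ‖u‖ ^ 2 * (2⁻¹ : ℝ) ^ (n + 1))) := by
            rw [hw_norm]; ring
          _ ≤ C * ‖u‖ ^ 2 * (2⁻¹ : ℝ) ^ (n + 1) := by
            rw [hpow, one_mul]
            exact mul_le_of_le_one_left (by positivity) (by norm_num)
      calc _ ≤ ‖q (n + 1) u - q n u‖ + ‖q n u - q 0 u‖ := norm_sub_le_norm_sub_add_norm_sub _ _ _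
        _ ≤ C * ‖u‖ ^ 2 * (2⁻¹ : ℝ) ^ (n + 1) + C * ‖u‖ ^ 2 * (1 - (2⁻¹ : ℝ) ^ n) := by gcongr
        _ = _ := by rw [pow_succ]; ring
  have hA_sub (u : E) (hu : ‖u‖ ≤ r) : ‖g (x + u) - g x - A' u‖ ≤ C * ‖u‖ ^ 2 := by
    have h1 : ‖A u - q 0 u‖ ≤ C * ‖u‖ ^ 2 := by
      refine le_of_tendsto ((hA u).sub_const _).norm (Eventually.of_forall fun n => ?_)
      refine (hq_sub u hu n).trans (mul_le_of_le_one_right (by positivity) ?_)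
      have : (0 : ℝ) ≤ (2⁻¹ : ℝ) ^ n := by positivity
      linarith
    rw [norm_sub_rev] at h1
    simp only [hq, pow_zero, one_smul] at h1
    exact h1
  refine ⟨A', ?_⟩
  rw [hasFDerivAt_iff_isLittleO_nhds_zero]
  refine Asymptotics.IsBigO.trans_isLittleO (g := fun u : E => ‖u‖ ^ 2)
    (Asymptotics.IsBigO.of_bound C ?_) ?_
  · filter_upwards [closedBall_mem_nhds (0 : E) hr] with u hu
    rw [mem_closedBall_zero_iff] at hu
    simpa using hA_sub u hu
  · exact Asymptotics.isLittleO_norm_pow_id one_lt_two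

/-- Second differences bounded by `C ‖u‖ ‖v‖` near a point bound the second derivative there. -/
lemma LipschitzWith.norm_fderiv_fderiv_le_of_norm_second_difference_le
    {E F : Type*} [NormedAddCommGroup E] [NormedSpace ℝ E] [NormedAddCommGroup F]
    [NormedSpace ℝ F] [ProperSpace F] {g : E → F} {M : NNReal} (hg : LipschitzWith M g)
    {x : E} {C r : ℝ} (hC : 0 ≤ C) (hr : 0 < r)
    (h : ∀ p u v : E, ‖p - x‖ ≤ r → ‖u‖ ≤ r → ‖v‖ ≤ r →
      ‖g (p + u + v) - g (p + u) - g (p + v) + g p‖ ≤ C * ‖u‖ * ‖v‖) :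
    ‖fderiv ℝ (fderiv ℝ g) x‖ ≤ C := by
  have hd (p : E) (hp : ‖p - x‖ ≤ r) : DifferentiableAt ℝ g p :=
    hg.differentiableAt_of_norm_second_difference_le hC hr fun u v => h p u v hp
  refine norm_fderiv_le_of_lip' ℝ hC ?_
  filter_upwards [closedBall_mem_nhds x hr] with y hy
  rw [mem_closedBall_iff_norm] at hy
  have h1 : HasFDerivAt (fun z => g (z + (y - x))) (fderiv ℝ g y) x := by
    refine (hasFDerivAt_comp_add_right (y - x)).mpr ?_
    simpa using (hd y hy).hasFDerivAt
  refine (h1.sub (hd x (by simpa using hr.le)).hasFDerivAt).le_of_lip' (by positivity) ?_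
  filter_upwards [closedBall_mem_nhds x hr] with z hz
  rw [mem_closedBall_iff_norm] at hz
  have h2 := h x (z - x) (y - x) (by simpa using hr.le) hz hy
  simp only [add_sub_cancel] at h2
  convert h2 using 1
  · simp only [Pi.sub_apply, add_sub_cancel]
    congr 1; abel
  · ring

/-- Mean value bound for second differences of a `C²` function. -/
lemma ContDiff.norm_second_difference_le
    {E F : Type*} [NormedAddCommGroup E] [NormedSpace ℝ E] [NormedAddCommGroup F]
    [NormedSpace ℝ F] {g : E → F} (hg : ContDiff ℝ 2 g) {e p q : E} {M R : ℝ}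
    (hR : ‖p‖ + ‖q‖ ≤ R)
    (hbd : ∀ x, ‖x - e‖ ≤ R → ‖iteratedFDeriv ℝ 2 g x‖ ≤ M) :
    ‖g (e + p + q) - g (e + p) - g (e + q) + g e‖ ≤ M * ‖p‖ * ‖q‖ := by
  have hd : Differentiable ℝ g := hg.differentiable (by norm_num)
  have hd' : Differentiable ℝ (fderiv ℝ g) :=
    (hg.fderiv_right (m := 1) (by norm_num)).differentiable (by norm_num)
  have hbd' (x : E) (hx : x ∈ closedBall e R) : ‖fderiv ℝ (fderiv ℝ g) x‖ ≤ M := by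
    rw [← norm_iteratedFDeriv_one, norm_iteratedFDeriv_fderiv]
    exact hbd x (by rwa [← mem_closedBall_iff_norm])
  have hderiv (x : E) : HasFDerivAt (fun y => g (y + p) - g y)
      (fderiv ℝ g (x + p) - fderiv ℝ g x) x :=
    ((hasFDerivAt_comp_add_right p).mpr (hd (x + p)).hasFDerivAt).sub (hd x).hasFDerivAt
  have key := (convex_closedBall e ‖q‖).norm_image_sub_le_of_norm_hasFDerivWithin_le
    (f := fun y => g (y + p) - g y) (C := M * ‖p‖) (x := e) (y := e + q)
    (fun x _ => (hderiv x).hasFDerivWithinAt) (fun x hx => ?_) (by simp) (by simp)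
  · convert key using 2
    · rw [add_right_comm]; abel
    · simp
  · rw [mem_closedBall_iff_norm] at hx
    have h1 : x ∈ closedBall e R := by
      rw [mem_closedBall_iff_norm]; linarith [norm_nonneg p]
    have h2 : x + p ∈ closedBall e R := by
      rw [mem_closedBall_iff_norm, add_sub_right_comm]
      linarith [norm_add_le (x - e) p]
    simpa using (convex_closedBall e R).norm_image_sub_le_of_norm_fderiv_le
      (fun y _ => hd' y) hbd' h1 h2

lemma EuclideanSpace.norm_le_card_mul {d : ℕ} (x : EuclideanSpace ℝ (Fin d)) {M : ℝ}
    (h : ∀ i, ‖x i‖ ≤ M) : ‖x‖ ≤ d * M := by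
  calc ‖x‖ = ‖∑ i, EuclideanSpace.single i (x i)‖ := by
        congr 1; ext j; simp [Pi.single_apply]
    _ ≤ ∑ i, ‖EuclideanSpace.single i (x i)‖ := norm_sum_le _ _
    _ ≤ ∑ _i : Fin d, M := Finset.sum_le_sum fun i _ => by simpa using h i
    _ = d * M := by simp

section Flow

variable {E : Type*} [NormedAddCommGroup E] [NormedSpace ℝ E] {f : E → E} {L : NNReal}

/-- Two global trajectories separate at most exponentially. -/
lemma LipschitzWith.norm_trajectory_sub_le (hlip : LipschitzWith L f) {a b : ℝ → E}
    (ha : ∀ t, HasDerivAt a (f (a t)) t) (hb : ∀ t, HasDerivAt b (f (b t)) t)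
    {t : ℝ} (ht : 0 ≤ t) : ‖a t - b t‖ ≤ ‖a 0 - b 0‖ * Real.exp (L * t) := by
  have := dist_le_of_trajectories_ODE (v := fun _ => f) (K := L) (f := a) (g := b) (a := 0)
    (b := t) (δ := ‖a 0 - b 0‖) (fun _ => hlip) (fun x _ => (ha x).continuousAt.continuousWithinAt)
    (fun x _ => (ha x).hasDerivWithinAt) (fun x _ => (hb x).continuousAt.continuousWithinAt)
    (fun x _ => (hb x).hasDerivWithinAt) (dist_eq_norm _ _).le t ⟨ht, le_rfl⟩
  simpa [dist_eq_norm] using this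

/-- Two global trajectories approach each other at most exponentially. -/
lemma LipschitzWith.norm_sub_le_trajectory (hlip : LipschitzWith L f) {a b : ℝ → E}
    (ha : ∀ t, HasDerivAt a (f (a t)) t) (hb : ∀ t, HasDerivAt b (f (b t)) t)
    {t : ℝ} (ht : 0 ≤ t) : ‖a 0 - b 0‖ ≤ ‖a t - b t‖ * Real.exp (L * t) := by
  have hrev {c : ℝ → E} (hc : ∀ t, HasDerivAt c (f (c t)) t) (x : ℝ) :
      HasDerivAt (fun y => c (t - y)) ((-f) (c (t - x))) x := by
    simpa [Function.comp_def] using (hc (t - x)).scomp x ((hasDerivAt_id x).const_sub t)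
  simpa using LipschitzWith.norm_trajectory_sub_le (f := -f) hlip.neg (hrev ha) (hrev hb) ht

/-- If the second difference of `f` along a configuration of four trajectories is at most `ε`
(up to closing the parallelogram), then the second difference of the trajectories stays of
order `ε`. -/
lemma LipschitzWith.norm_second_difference_trajectory_le (hlip : LipschitzWith L f)
    {a b c e : ℝ → E}
    (ha : ∀ t, HasDerivAt a (f (a t)) t) (hb : ∀ t, HasDerivAt b (f (b t)) t)
    (hc : ∀ t, HasDerivAt c (f (c t)) t) (he : ∀ t, HasDerivAt e (f (e t)) t)
    (h0 : a 0 - b 0 - c 0 + e 0 = 0) {T ε : ℝ} (hε : 0 ≤ ε)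
    (hbd : ∀ τ ∈ Set.Icc 0 T, ‖f (b τ + c τ - e τ) - f (b τ) - f (c τ) + f (e τ)‖ ≤ ε)
    {t : ℝ} (ht : t ∈ Set.Icc 0 T) :
    ‖a t - b t - c t + e t‖ ≤ ε * Real.exp ((L + 1) * T) := by
  have hder (τ : ℝ) : HasDerivAt (fun τ => a τ - b τ - c τ + e τ)
      (f (a τ) - f (b τ) - f (c τ) + f (e τ)) τ := (((ha τ).sub (hb τ)).sub (hc τ)).add (he τ)
  have hL : (1 : ℝ) ≤ L + 1 := by simp
  have key := norm_le_gronwallBound_of_norm_deriv_right_le (a := 0) (b := T) (δ := 0)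
    (K := L + 1) (ε := ε) (fun τ _ => (hder τ).continuousAt.continuousWithinAt)
    (fun τ _ => (hder τ).hasDerivWithinAt) (by simp [h0]) (fun τ hτ => ?_) t ht
  · rw [gronwallBound_of_K_ne_0 (by positivity)] at key
    refine key.trans ?_
    simp only [zero_mul, zero_add, sub_zero]
    have h1 : Real.exp ((L + 1) * t) ≤ Real.exp ((L + 1) * T) := by
      gcongr; exact ht.2
    have h2 : 1 ≤ Real.exp ((L + 1) * t) := Real.one_le_exp (mul_nonneg (by positivity) ht.1)
    exact mul_le_mul (div_le_self hε hL) (by linarith) (by linarith) hε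
  · have h1 := hlip.norm_sub_le (a τ) (b τ + c τ - e τ)
    have h2 := hbd τ ⟨hτ.1, hτ.2.le⟩
    have h3 : a τ - (b τ + c τ - e τ) = a τ - b τ - c τ + e τ := by abel
    rw [h3] at h1
    calc ‖f (a τ) - f (b τ) - f (c τ) + f (e τ)‖
        = ‖(f (a τ) - f (b τ + c τ - e τ)) +
          (f (b τ + c τ - e τ) - f (b τ) - f (c τ) + f (e τ))‖ := by congr 1; abel
      _ ≤ _ := norm_add_le _ _
      _ ≤ (L + 1) * ‖a τ - b τ - c τ + e τ‖ + ε := by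
        linarith [norm_nonneg (a τ - b τ - c τ + e τ)]

end Flow


theorem stmt_12 {d : ℕ}
    (f : EuclideanSpace ℝ (Fin d) → EuclideanSpace ℝ (Fin d)) (L : NNReal)
    (hf : ContDiff ℝ 2 f) (hlip : LipschitzWith L f)
    (θstar : EuclideanSpace ℝ (Fin d)) (hzero : f θstar = 0)
    (K : ℝ)
    (hHessf : ∀ (i : Fin d) (θ : EuclideanSpace ℝ (Fin d)),
      ‖iteratedFDeriv ℝ 2 (fun x => f x i) θ‖ * ‖θ - θstar‖ ≤ K)
    (s : ℝ → EuclideanSpace ℝ (Fin d) → EuclideanSpace ℝ (Fin d))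
    (hs0 : ∀ θ, s 0 θ = θ)
    (hsode : ∀ (θ : EuclideanSpace ℝ (Fin d)) (t : ℝ),
      HasDerivAt (fun τ => s τ θ) (f (s t θ)) t)
    (T : ℝ) (hT : 0 < T) :
    ∃ C₃ : ℝ, 0 < C₃ ∧ ∀ (t : ℝ), t ∈ Set.Icc (0:ℝ) T →
      ∀ (θ : EuclideanSpace ℝ (Fin d)), θ ≠ θstar →
      ∀ (i j k : Fin d),
        |iteratedFDeriv ℝ 2 (fun θ' => s t θ' i) θ
          ![EuclideanSpace.single j (1:ℝ), EuclideanSpace.single k (1:ℝ)]|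
          ≤ C₃ / ‖θ - θstar‖ := by
  set B : ℝ := Real.exp (L * T) with hB
  have hB1 : 1 ≤ B := Real.one_le_exp (by positivity)
  have hB0 : 0 < B := by positivity
  set C : ℝ := d * (4 * |K| * B) * B ^ 2 * Real.exp ((L + 1) * T) with hC
  have hC0 : 0 ≤ C := by positivity
  refine ⟨C + 1, by positivity, fun t ht θ hθ i j k => ?_⟩
  set ρ : ℝ := ‖θ - θstar‖ with hρdef
  have hρ : 0 < ρ := norm_pos_iff.mpr (sub_ne_zero.mpr hθ)
  have hexp (τ : ℝ) (hτ : τ ∈ Set.Icc 0 T) : Real.exp (L * τ) ≤ B := by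
    rw [hB]; gcongr; exact hτ.2
  have hstar (τ : ℝ) : HasDerivAt (fun _ : ℝ => θstar) (f θstar) τ := by
    rw [hzero]; exact hasDerivAt_const _ _
  have hupper (τ : ℝ) (hτ : τ ∈ Set.Icc 0 T) (x y : EuclideanSpace ℝ (Fin d)) :
      ‖s τ x - s τ y‖ ≤ B * ‖x - y‖ := by
    have h1 := hlip.norm_trajectory_sub_le (hsode x) (hsode y) hτ.1
    simp only [hs0] at h1
    rw [mul_comm]
    exact h1.trans (by gcongr; exact hexp τ hτ)
  have hlower (τ : ℝ) (hτ : τ ∈ Set.Icc 0 T) (x : EuclideanSpace ℝ (Fin d)) :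
      ‖x - θstar‖ ≤ ‖s τ x - θstar‖ * B := by
    have h1 := hlip.norm_sub_le_trajectory (hsode x) hstar hτ.1
    simp only [hs0] at h1
    exact h1.trans (by gcongr; exact hexp τ hτ)
  set r : ℝ := ρ / (8 * B ^ 2) with hrdef
  have hr : 0 < r := by positivity
  have hr_le : r ≤ ρ / 2 := by
    rw [hrdef]; gcongr; nlinarith
  have hBr : B * r + B * r = ρ / (4 * B) := by
    rw [hrdef]; field_simp; ring
  have hdiff (p u v : EuclideanSpace ℝ (Fin d)) (hp : ‖p - θ‖ ≤ r) (hu : ‖u‖ ≤ r)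
      (hv : ‖v‖ ≤ r) :
      ‖s t (p + u + v) - s t (p + u) - s t (p + v) + s t p‖ ≤ C / ρ * ‖u‖ * ‖v‖ := by
    have hε : 0 ≤ d * (4 * |K| * B / ρ * (B * ‖u‖) * (B * ‖v‖)) := by positivity
    refine (hlip.norm_second_difference_trajectory_le (hsode (p + u + v)) (hsode (p + u))
      (hsode (p + v)) (hsode p) (by simp only [hs0]; abel) hε (fun τ hτ => ?_) ht).trans
      (le_of_eq (by rw [hC]; ring))
    refine EuclideanSpace.norm_le_card_mul _ fun l => ?_
    have hu' : ‖s τ (p + u) - s τ p‖ ≤ B * ‖u‖ := by simpa using hupper τ hτ (p + u) p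
    have hv' : ‖s τ (p + v) - s τ p‖ ≤ B * ‖v‖ := by simpa using hupper τ hτ (p + v) p
    have hur : B * ‖u‖ ≤ B * r := by gcongr
    have hvr : B * ‖v‖ ≤ B * r := by gcongr
    have hp' : ρ / 2 ≤ ‖p - θstar‖ := by
      have := norm_sub_le_norm_sub_add_norm_sub θ p θstar
      rw [norm_sub_rev θ p] at this
      linarith
    have hfar : ρ / (2 * B) ≤ ‖s τ p - θstar‖ := by
      rw [← div_div, div_le_iff₀ hB0]
      exact hp'.trans (hlower τ hτ p)
    have hfl : ContDiff ℝ 2 (fun x => f x l) := by fun_prop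
    have key := hfl.norm_second_difference_le (e := s τ p) (p := s τ (p + u) - s τ p)
      (q := s τ (p + v) - s τ p) (M := 4 * |K| * B / ρ) (R := ρ / (4 * B))
      (by linarith) (fun x hx => ?_)
    · rw [show s τ p + (s τ (p + u) - s τ p) + (s τ (p + v) - s τ p) =
        s τ (p + u) + s τ (p + v) - s τ p by abel, add_sub_cancel, add_sub_cancel] at key
      simp only [PiLp.add_apply, PiLp.sub_apply]
      exact key.trans (by gcongr)
    · have hx' : ρ / (4 * B) ≤ ‖x - θstar‖ := by
        have h1 := norm_sub_le_norm_sub_add_norm_sub (s τ p) x θstar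
        rw [norm_sub_rev (s τ p) x] at h1
        have h2 : ρ / (2 * B) = ρ / (4 * B) + ρ / (4 * B) := by field_simp; ring
        linarith
      have h3 : ‖iteratedFDeriv ℝ 2 (fun x => f x l) x‖ * (ρ / (4 * B)) ≤ |K| :=
        (mul_le_mul_of_nonneg_left hx' (norm_nonneg _)).trans
          ((hHessf l x).trans (le_abs_self K))
      rw [← le_div_iff₀ (by positivity)] at h3
      exact h3.trans (le_of_eq (by field_simp))
  have hlip_s : LipschitzWith B.toNNReal (fun x => s t x i) :=
    LipschitzWith.of_dist_le_mul fun x y => by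
      rw [dist_eq_norm, dist_eq_norm, Real.coe_toNNReal _ hB0.le, ← PiLp.sub_apply]
      exact (PiLp.norm_apply_le _ i).trans (hupper t ht x y)
  have hsecond := hlip_s.norm_fderiv_fderiv_le_of_norm_second_difference_le (x := θ)
    (C := C / ρ) (by positivity) hr fun p u v hp hu hv => by
      simp only [← PiLp.sub_apply, ← PiLp.add_apply]
      exact (PiLp.norm_apply_le _ i).trans (hdiff p u v hp hu hv)
  rw [iteratedFDeriv_two_apply, ← Real.norm_eq_abs]
  refine (ContinuousLinearMap.le_opNorm₂ _ _ _).trans ?_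
  simp only [Matrix.cons_val_zero, Matrix.cons_val_one, PiLp.norm_single, norm_one,
    mul_one]
  exact hsecond.trans (by gcongr; linarith)
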